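/- Let A be a Banach algebra with a bounded approximate identity, and suppose that the space of continuous traces A^{tr} = {f ∈ A* : f(ab) = f(ba) for all a,b ∈ A} is zero and that the continuous Hochschild cohomology groups Hⁿ(A, A*) vanish for all n ≥ 1. Then the continuous cyclic cohomology groups HCⁿ(A) vanish for all n ≥ 0. -/

import Mathlib

/-!
STATEMENT 16: Let `A` be a Banach algebra with a bounded approximate identity
such that every continuous trace on `A` is zero and the continuous Hochschild
cohomology groups `Hⁿ(A, A*)` vanish for all `n ≥ 1` (via the identification of
`Cⁿ(A,A*)` with bounded `(n+1)`-linear functionals, with coboundary `cycδ`).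
Then the continuous cyclic cohomology groups `HCⁿ(A)` vanish for all `n ≥ 0`:
`HC⁰(A) = 0` (every cyclic `0`-cocycle is zero) and, for `n ≥ 1`, every cyclic
`n`-cocycle is the coboundary of a cyclic `(n-1)`-cochain.
-/

open Finset Filter

/-- Merge the arguments `a i` and `a (i+1)` of an `(n+2)`-tuple into a product. -/
def cycMerge {A : Type*} [Mul A] {n : ℕ} (a : Fin (n + 2) → A) (i : Fin (n + 1)) :
    Fin (n + 1) → A := fun j =>
  if (j : ℕ) < (i : ℕ) then a j.castSucc
  else if (j : ℕ) = (i : ℕ) then a j.castSucc * a j.succ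
  else a j.succ

/-- The (simplicial/cyclic) coboundary on `(n+1)`-linear functionals. -/
noncomputable def cycδ {A : Type*} [Mul A] {n : ℕ}
    (f : (Fin (n + 1) → A) → ℂ) : (Fin (n + 2) → A) → ℂ := fun a =>
  (∑ i : Fin (n + 1), ((-1 : ℂ) ^ (i : ℕ)) * f (cycMerge a i))
    + ((-1 : ℂ) ^ (n + 1)) *
        f (fun j => if (j : ℕ) = 0 then a (Fin.last (n + 1)) * a 0 else a j.castSucc)

/-- The signed cyclic permutation operator `tₙ`. -/
noncomputable def cycT {A : Type*} {n : ℕ}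
    (f : (Fin (n + 1) → A) → ℂ) : (Fin (n + 1) → A) → ℂ := fun a =>
  ((-1 : ℂ) ^ n) * f (fun j => a (j + 1))

namespace CycAux

/-- All face maps (indexed by naturals) on tuples. -/
def face {A : Type*} [Mul A] (n i : ℕ) (a : Fin (n + 2) → A) : Fin (n + 1) → A := fun j =>
  if i ≤ n then
    (if (j : ℕ) < i then a j.castSucc
      else if (j : ℕ) = i then a j.castSucc * a j.succ
      else a j.succ)
  else (if (j : ℕ) = 0 then a (Fin.last (n + 1)) * a 0 else a j.castSucc)

/-- Rotation of tuples. -/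
def rot {A : Type*} (n : ℕ) (a : Fin (n + 1) → A) : Fin (n + 1) → A := fun j => a (j - 1)

theorem rot_apply {A : Type*} (n : ℕ) (a : Fin (n + 1) → A) (j : Fin (n + 1)) :
    rot n a j = if (j : ℕ) = 0 then a (Fin.last n) else a ⟨(j : ℕ) - 1, by omega⟩ := by
  unfold rot
  split_ifs with h
  · congr 1
    have : j = 0 := Fin.ext h
    subst this
    ext
    simp [Fin.sub_def]
  · congr 1
    have : j ≠ 0 := fun h' => h (by simp [h'])
    ext
    simp [Fin.val_sub_one_of_ne_zero this]

theorem exists_ext {A : Type*} (n : ℕ) (a : Fin (n + 1) → A) :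
    ∃ c : ℕ → A, ∀ x, a x = c (x : ℕ) :=
  ⟨fun k => a (Fin.ofNat (n + 1) k), fun x => by simp⟩

theorem face_face {A : Type*} [Semigroup A] (n i j : ℕ) (hij : i < j) (hj : j ≤ n + 2)
    (a : Fin (n + 3) → A) :
    face n i (face (n + 1) j a) = face n (j - 1) (face (n + 1) i a) := by
  obtain ⟨j, rfl⟩ : ∃ k, j = k + 1 := ⟨j - 1, by omega⟩
  obtain ⟨c, hc⟩ := exists_ext _ a
  funext ⟨k, hk⟩
  rcases Nat.lt_or_ge n j with h | h
  · have h1 : ¬ (j + 1 ≤ n + 1) := by omega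
    have h2 : ¬ (j ≤ n) := by omega
    have h3 : i ≤ n + 1 := by omega
    simp only [face, hc, Fin.val_castSucc, Fin.val_succ, Fin.val_last, Nat.add_sub_cancel,
      Fin.val_zero, h1, h2, h3, if_true, if_false]
    split_ifs <;> first
      | omega
      | rfl
      | exact mul_assoc _ _ _
      | exact (mul_assoc _ _ _).symm
      | (subst_vars; simp [mul_assoc]; done)
      | (subst_vars; congr 1; omega)
      | grind
  · have h1 : j + 1 ≤ n + 1 := by omega
    have h2 : i ≤ n := by omega
    have h3 : i ≤ n + 1 := by omega
    simp only [face, hc, Fin.val_castSucc, Fin.val_succ, Nat.add_sub_cancel, h, h1, h2, h3,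
      if_true]
    split_ifs <;> first
      | omega
      | rfl
      | exact mul_assoc _ _ _
      | exact (mul_assoc _ _ _).symm

theorem face_rot_succ {A : Type*} [Mul A] (n i : ℕ) (hi : i ≤ n) (a : Fin (n + 2) → A) :
    face n (i + 1) (rot (n + 1) a) = rot n (face n i a) := by
  obtain ⟨c, hc⟩ := exists_ext _ a
  funext ⟨k, hk⟩
  rw [rot_apply]
  simp only [face, rot_apply, hc, Fin.val_castSucc, Fin.val_succ, Fin.val_last, Fin.val_zero]
  split_ifs <;> first
    | omega
    | rfl
    | grind

theorem face_rot_zero {A : Type*} [Mul A] (n : ℕ) (a : Fin (n + 2) → A) :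
    face n 0 (rot (n + 1) a) = face n (n + 1) a := by
  obtain ⟨c, hc⟩ := exists_ext _ a
  funext ⟨k, hk⟩
  simp only [face, rot_apply, hc, Fin.val_castSucc, Fin.val_succ, Fin.val_last, Fin.val_zero]
  split_ifs <;> first
    | omega
    | rfl
    | grind

/-- Functionals on tuples. -/
abbrev V (A : Type*) (n : ℕ) := (Fin (n + 1) → A) → ℂ

/-- Signed rotation. -/
def s (A : Type*) (n : ℕ) : V A n →ₗ[ℂ] V A n where
  toFun f := fun a => (-1 : ℂ) ^ n * f (rot n a)
  map_add' f g := by funext a; simp [mul_add]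
  map_smul' c f := by funext a; simp; ring

/-- Dual faces. -/
def d (A : Type*) [Mul A] (n i : ℕ) : V A n →ₗ[ℂ] V A (n + 1) where
  toFun f := fun a => f (face n i a)
  map_add' _ _ := rfl
  map_smul' _ _ := rfl

/-- Hochschild coboundary. -/
def b (A : Type*) [Mul A] (n : ℕ) : V A n →ₗ[ℂ] V A (n + 1) :=
  ∑ i ∈ range (n + 2), (-1 : ℂ) ^ i • d A n i

/-- Bar coboundary. -/
def bar (A : Type*) [Mul A] (n : ℕ) : V A n →ₗ[ℂ] V A (n + 1) :=
  ∑ i ∈ range (n + 1), (-1 : ℂ) ^ i • d A n i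

/-- Norm operator. -/
def N (A : Type*) (n : ℕ) : V A n →ₗ[ℂ] V A n :=
  ∑ i ∈ range (n + 1), (s A n) ^ i

theorem s_d_succ {A : Type*} [Mul A] (n i : ℕ) (hi : i ≤ n) (f : V A n) :
    s A (n + 1) (d A n (i + 1) f) = - d A n i (s A n f) := by
  funext a
  simp [s, d, face_rot_succ n i hi, pow_succ]

theorem s_d_zero {A : Type*} [Mul A] (n : ℕ) (f : V A n) :
    s A (n + 1) (d A n 0 f) = (-1 : ℂ) ^ (n + 1) • d A n (n + 1) f := by
  funext a
  simp [s, d, face_rot_zero n]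

theorem b_eq {A : Type*} [Mul A] (n : ℕ) (f : V A n) : b A n f = cycδ f := by
  funext a
  simp only [b, cycδ, LinearMap.sum_apply, LinearMap.smul_apply, Finset.sum_apply,
    Pi.smul_apply, smul_eq_mul]
  rw [Finset.sum_range_succ, Finset.sum_range]
  congr 1
  · refine Finset.sum_congr rfl fun i _ => ?_
    congr 1
    simp only [d, LinearMap.coe_mk, AddHom.coe_mk]
    congr 1
    funext j
    simp [face, cycMerge, Nat.lt_succ_iff.mp i.2]
  · congr 1
    simp only [d, LinearMap.coe_mk, AddHom.coe_mk]
    congr 1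
    funext j
    simp [face]

theorem sum_cancel {M : Type*} [AddCommGroup M] [Module ℂ M] (F : ℕ → ℕ → M) (m : ℕ)
    (hF : ∀ i j, i < j → j ≤ m → F j i = F i (j - 1)) :
    ∑ j ∈ range (m + 1), ∑ i ∈ range m, ((-1 : ℂ) ^ j * (-1) ^ i) • F j i = 0 := by
  induction m with
  | zero => simp
  | succ m ih =>
    rw [Finset.sum_range_succ]
    rw [Finset.sum_congr rfl fun j _ =>
      Finset.sum_range_succ (fun i => ((-1 : ℂ) ^ j * (-1) ^ i) • F j i) m]
    rw [Finset.sum_add_distrib, ih (fun i j h h' => hF i j h (by omega)), zero_add,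
      ← Finset.sum_add_distrib]
    refine Finset.sum_eq_zero fun i hi => ?_
    rw [hF i (m + 1) (by simpa using hi) le_rfl, Nat.add_sub_cancel, ← add_smul]
    convert zero_smul ℂ _
    ring

theorem d_d {A : Type*} [Semigroup A] (n i j : ℕ) (hij : i < j) (hj : j ≤ n + 2) (f : V A n) :
    d A (n + 1) j (d A n i f) = d A (n + 1) i (d A n (j - 1) f) := by
  funext a
  simp only [d, LinearMap.coe_mk, AddHom.coe_mk]
  rw [face_face n i j hij hj]

theorem b_b {A : Type*} [Semigroup A] (n : ℕ) (f : V A n) : b A (n + 1) (b A n f) = 0 := by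
  have := sum_cancel (fun j i => d A (n + 1) j (d A n i f)) (n + 2)
    (fun i j h h' => d_d n i j h h' f)
  simp only [b, LinearMap.sum_apply, LinearMap.smul_apply, map_sum, map_smul, Finset.smul_sum,
    smul_smul]
  rw [Finset.sum_comm, ← this]
  exact Finset.sum_congr rfl fun j _ => Finset.sum_congr rfl fun i _ => by rw [mul_comm]

theorem bar_bar {A : Type*} [Semigroup A] (n : ℕ) (f : V A n) : bar A (n + 1) (bar A n f) = 0 := by
  have := sum_cancel (fun j i => d A (n + 1) j (d A n i f)) (n + 1)
    (fun i j h h' => d_d n i j h (by omega) f)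
  simp only [bar, LinearMap.sum_apply, LinearMap.smul_apply, map_sum, map_smul, Finset.smul_sum,
    smul_smul]
  rw [Finset.sum_comm, ← this]
  exact Finset.sum_congr rfl fun j _ => Finset.sum_congr rfl fun i _ => by rw [mul_comm]

theorem s_b {A : Type*} [Mul A] (n : ℕ) (f : V A n) :
    s A (n + 1) (b A n f) = bar A n (s A n f) + b A n f - bar A n f := by
  have h1 : b A n f - bar A n f = (-1 : ℂ) ^ (n + 1) • d A n (n + 1) f := by
    simp [b, bar, Finset.sum_range_succ _ (n + 1)]
  rw [add_sub_assoc, h1, ← s_d_zero, b, Finset.sum_range_succ']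
  simp only [bar, LinearMap.add_apply, LinearMap.sum_apply, map_add, map_sum, LinearMap.smul_apply,
    map_smul, pow_zero, one_smul]
  congr 1
  refine Finset.sum_congr rfl fun i hi => ?_
  rw [s_d_succ n i (by simpa [Nat.lt_succ_iff] using hi)]
  simp [pow_succ]

theorem s_pow_apply {A : Type*} (n k : ℕ) (f : V A n) (a : Fin (n + 1) → A) :
    ((s A n) ^ k) f a = ((-1 : ℂ) ^ n) ^ k * f (fun j => a (j - k • (1 : Fin (n + 1)))) := by
  induction k generalizing a with
  | zero => simp
  | succ k ih =>
    rw [pow_succ']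
    simp only [Module.End.mul_apply]
    simp only [s, LinearMap.coe_mk, AddHom.coe_mk] at ih ⊢
    rw [ih, pow_succ', mul_assoc]
    congr 3
    funext j
    simp only [rot, succ_nsmul]
    congr 1
    abel

theorem s_pow {A : Type*} (n : ℕ) : (s A n) ^ (n + 1) = 1 := by
  ext f a
  rw [s_pow_apply]
  have : (n + 1) • (1 : Fin (n + 1)) = 0 := by
    simpa using card_nsmul_eq_zero (x := (1 : Fin (n + 1)))
  rw [this, ← pow_mul, (Nat.even_mul_succ_self n).neg_one_pow]
  simp

theorem N_mul_s {A : Type*} (n : ℕ) : N A n * s A n = N A n := by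
  have h := geom_sum_mul (s A n) (n + 1)
  rw [s_pow, sub_self, mul_sub, mul_one, sub_eq_zero] at h
  exact h

theorem s_mul_N {A : Type*} (n : ℕ) : s A n * N A n = N A n := by
  have h := mul_geom_sum (s A n) (n + 1)
  rw [s_pow, sub_self, sub_mul, one_mul, sub_eq_zero] at h
  exact h

theorem N_s {A : Type*} (n : ℕ) (f : V A n) : N A n (s A n f) = N A n f :=
  congrArg (fun L => L f) (N_mul_s n)

theorem s_N {A : Type*} (n : ℕ) (f : V A n) : s A n (N A n f) = N A n f :=
  congrArg (fun L => L f) (s_mul_N n)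

theorem N_of_inv {A : Type*} (n : ℕ) (f : V A n) (hf : s A n f = f) :
    N A n f = ((n : ℂ) + 1) • f := by
  have : ∀ k, ((s A n) ^ k) f = f := by
    intro k
    induction k with
    | zero => rfl
    | succ k ih => rw [pow_succ, Module.End.mul_apply, hf, ih]
  simp only [N, LinearMap.sum_apply, this, Finset.sum_const, Finset.card_range]
  rw [← Nat.cast_smul_eq_nsmul ℂ]
  simp

theorem N_N {A : Type*} (n : ℕ) (f : V A n) :
    N A n (N A n f) = ((n : ℂ) + 1) • N A n f := N_of_inv n _ (s_N n f)

theorem N_d_N {A : Type*} [Mul A] (n i : ℕ) (hi : i ≤ n + 1) (f : V A n) :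
    (-1 : ℂ) ^ i • N A (n + 1) (d A n i (N A n f)) = N A (n + 1) (d A n 0 (N A n f)) := by
  induction i with
  | zero => simp
  | succ i ih =>
    rw [← ih (by omega), ← N_s (n + 1) (d A n (i + 1) (N A n f)), s_d_succ n i (by omega), s_N]
    simp [pow_succ]

theorem N_b_N {A : Type*} [Mul A] (n : ℕ) (f : V A n) :
    N A (n + 1) (b A n (N A n f)) = ((n : ℂ) + 2) • N A (n + 1) (d A n 0 (N A n f)) := by
  simp only [b, LinearMap.sum_apply, LinearMap.smul_apply, map_sum, map_smul]
  rw [Finset.sum_congr rfl fun i hi => N_d_N n i (by simp at hi; omega) f]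
  rw [Finset.sum_const, Finset.card_range, ← Nat.cast_smul_eq_nsmul ℂ]
  simp

theorem N_bar_N {A : Type*} [Mul A] (n : ℕ) (f : V A n) :
    N A (n + 1) (bar A n (N A n f)) = ((n : ℂ) + 1) • N A (n + 1) (d A n 0 (N A n f)) := by
  simp only [bar, LinearMap.sum_apply, LinearMap.smul_apply, map_sum, map_smul]
  rw [Finset.sum_congr rfl fun i hi => N_d_N n i (by simp at hi; omega) f]
  rw [Finset.sum_const, Finset.card_range, ← Nat.cast_smul_eq_nsmul ℂ]
  simp

theorem N_bar {A : Type*} [Mul A] (n : ℕ) (f : V A n) :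
    N A (n + 1) (bar A n f) = b A n (N A n f) := by
  have hn1 : ((n : ℂ) + 1) ≠ 0 := by exact_mod_cast Nat.succ_ne_zero n
  have hn2 : ((n : ℂ) + 2) ≠ 0 := by exact_mod_cast Nat.succ_ne_zero (n + 1)
  have e1 : ∀ g : V A n, N A (n + 1) (bar A n (s A n g)) = N A (n + 1) (bar A n g) := by
    intro g
    have h := congrArg (N A (n + 1)) (s_b n g)
    rw [N_s, map_sub, map_add] at h
    have h2 : N A (n + 1) (bar A n (s A n g)) - N A (n + 1) (bar A n g) = 0 := by
      have := sub_eq_zero.mpr h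
      rw [← neg_eq_zero, ← this]; abel
    exact sub_eq_zero.mp h2
  have e2 : N A (n + 1) (bar A n (N A n f)) = ((n : ℂ) + 1) • N A (n + 1) (bar A n f) := by
    have : ∀ k, N A (n + 1) (bar A n (((s A n) ^ k) f)) = N A (n + 1) (bar A n f) := by
      intro k
      induction k with
      | zero => rfl
      | succ k ih => rw [pow_succ', Module.End.mul_apply, e1, ih]
    have hN : N A n f = ∑ i ∈ range (n + 1), ((s A n) ^ i) f := by
      simp [N, LinearMap.sum_apply]
    rw [hN]
    simp only [map_sum, this, Finset.sum_const, Finset.card_range]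
    rw [← Nat.cast_smul_eq_nsmul ℂ]
    simp
  have e3 : N A (n + 1) (b A n (N A n f)) = ((n : ℂ) + 2) • b A n (N A n f) := by
    rw [N_of_inv]
    · congr 1; push_cast; ring
    · rw [s_b, s_N]; abel
  rw [N_bar_N] at e2
  rw [N_b_N] at e3
  exact (smul_right_injective _ hn1 e2).symm.trans (smul_right_injective _ hn2 e3)

theorem exists_of_N_eq_zero {A : Type*} (n : ℕ) (P : Submodule ℂ (V A n))
    (hP : ∀ f ∈ P, s A n f ∈ P) (f : V A n) (hfP : f ∈ P) (hf : N A n f = 0) :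
    ∃ g ∈ P, g - s A n g = f := by
  have hn1 : ((n : ℂ) + 1) ≠ 0 := by exact_mod_cast Nat.succ_ne_zero n
  have hpow : ∀ k, ((s A n) ^ k) f ∈ P := by
    intro k
    induction k with
    | zero => exact hfP
    | succ k ih => rw [pow_succ', Module.End.mul_apply]; exact hP _ ih
  refine ⟨((n : ℂ) + 1)⁻¹ • ∑ j ∈ range (n + 1), ∑ i ∈ range j, ((s A n) ^ i) f,
    P.smul_mem _ (P.sum_mem fun j _ => P.sum_mem fun i _ => hpow i), ?_⟩
  have key : ∀ j, ∑ i ∈ range j, ((s A n) ^ i) f - s A n (∑ i ∈ range j, ((s A n) ^ i) f)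
      = f - ((s A n) ^ j) f := by
    intro j
    have := congrArg (fun L => L f) (mul_neg_geom_sum (s A n) j)
    simpa [sub_mul, LinearMap.sum_apply] using this
  rw [map_smul, ← smul_sub, map_sum, ← Finset.sum_sub_distrib]
  simp only [key]
  rw [Finset.sum_sub_distrib]
  have h0 : ∑ j ∈ range (n + 1), ((s A n) ^ j) f = 0 := by
    simpa [N, LinearMap.sum_apply] using hf
  rw [h0, sub_zero, Finset.sum_const, Finset.card_range, ← Nat.cast_smul_eq_nsmul ℂ, smul_smul]
  push_cast
  rw [inv_mul_cancel₀ hn1, one_smul]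

section CM

variable {A : Type*} [NonUnitalNormedRing A] [NormedSpace ℂ A]

/-- The continuous multilinear functionals. -/
def CM (A : Type*) [NonUnitalNormedRing A] [NormedSpace ℂ A] (n : ℕ) : Submodule ℂ (V A n) where
  carrier := {F | ∃ f : ContinuousMultilinearMap ℂ (fun _ : Fin (n + 1) => A) ℂ, ⇑f = F}
  add_mem' := by
    rintro _ _ ⟨f, rfl⟩ ⟨g, rfl⟩
    exact ⟨f + g, rfl⟩
  zero_mem' := ⟨0, rfl⟩
  smul_mem' := by
    rintro c _ ⟨f, rfl⟩
    exact ⟨c • f, rfl⟩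

theorem s_mem (n : ℕ) (F : V A n) (hF : F ∈ CM A n) : s A n F ∈ CM A n := by
  obtain ⟨f, rfl⟩ := hF
  have : (fun a => f (rot n a)) ∈ CM A n :=
    ⟨f.domDomCongr (Equiv.subRight (1 : Fin (n + 1))), by
      funext a; rfl⟩
  exact (CM A n).smul_mem ((-1 : ℂ) ^ n) this

theorem N_mem (n : ℕ) (F : V A n) (hF : F ∈ CM A n) : N A n F ∈ CM A n := by
  rw [N, LinearMap.sum_apply]
  refine Submodule.sum_mem _ fun k hk => ?_
  clear hk
  induction k with
  | zero => exact hF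
  | succ k ih => rw [pow_succ', Module.End.mul_apply]; exact s_mem _ _ ih

/-- Composition with maps on tuples that are linear in each slot. -/
theorem comp_mem (n m : ℕ) (F : V A n) (hF : F ∈ CM A n)
    (φ : (Fin (m + 1) → A) → (Fin (n + 1) → A)) (hφ : Continuous φ)
    (h : ∀ (a : Fin (m + 1) → A) (k : Fin (m + 1)), ∃ (k' : Fin (n + 1)) (L : A →ₗ[ℂ] A),
      ∀ x, φ (Function.update a k x) = Function.update (φ a) k' (L x)) :
    (fun a => F (φ a)) ∈ CM A m := by
  obtain ⟨f, rfl⟩ := hF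
  refine ⟨⟨⟨fun a => f (φ a), ?_, ?_⟩, f.cont.comp hφ⟩, rfl⟩
  · intro inst a k x y
    obtain ⟨k', L, hL⟩ := h a k
    have e : inst = instDecidableEqFin (m + 1) := Subsingleton.elim _ _
    subst e
    simp only [hL, map_add, f.map_update_add]
  · intro inst a k c x
    obtain ⟨k', L, hL⟩ := h a k
    have e : inst = instDecidableEqFin (m + 1) := Subsingleton.elim _ _
    subst e
    simp only [hL, map_smul, f.map_update_smul]

variable [IsScalarTower ℂ A A] [SMulCommClass ℂ A A]

theorem d_mem_aux (n i : ℕ) (hi : i ≤ n) (F : V A n) (hF : F ∈ CM A n) :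
    d A n i F ∈ CM A (n + 1) := by
  refine comp_mem n (n + 1) F hF (face n i) ?_ ?_
  · refine continuous_pi fun j => ?_
    simp only [face]
    split_ifs <;> fun_prop
  · rintro a ⟨k, hk⟩
    rcases lt_trichotomy k i with h | h | h
    · refine ⟨⟨k, by omega⟩, LinearMap.id, fun x => ?_⟩
      funext ⟨j, hj⟩
      simp only [face, Function.update_apply, Fin.ext_iff, Fin.val_castSucc, Fin.val_succ,
        LinearMap.id_apply]
      split_ifs <;> first | omega | rfl
    · refine ⟨⟨i, by omega⟩, LinearMap.mulRight ℂ (a ⟨i + 1, by omega⟩), fun x => ?_⟩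
      funext ⟨j, hj⟩
      simp only [face, Function.update_apply, Fin.ext_iff, Fin.val_castSucc, Fin.val_succ,
        LinearMap.mulRight_apply]
      split_ifs <;> first | omega | rfl | (subst_vars; rfl)
    · rcases eq_or_lt_of_le (Nat.succ_le_of_lt h) with h | h
      · refine ⟨⟨i, by omega⟩, LinearMap.mulLeft ℂ (a ⟨i, by omega⟩), fun x => ?_⟩
        funext ⟨j, hj⟩
        simp only [face, Function.update_apply, Fin.ext_iff, Fin.val_castSucc, Fin.val_succ,
          LinearMap.mulLeft_apply]
        split_ifs <;> first | omega | rfl | (subst_vars; rfl)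
      · refine ⟨⟨k - 1, by omega⟩, LinearMap.id, fun x => ?_⟩
        funext ⟨j, hj⟩
        simp only [face, Function.update_apply, Fin.ext_iff, Fin.val_castSucc, Fin.val_succ,
          LinearMap.id_apply]
        split_ifs <;> first | omega | rfl

theorem d_mem (n i : ℕ) (hi : i ≤ n + 1) (F : V A n) (hF : F ∈ CM A n) :
    d A n i F ∈ CM A (n + 1) := by
  rcases Nat.lt_or_ge n i with h | h
  · obtain rfl : i = n + 1 := by omega
    have h1 := s_mem _ _ (d_mem_aux n 0 (Nat.zero_le _) F hF)
    rw [s_d_zero] at h1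
    exact ((CM A (n + 1)).smul_mem_iff (by simp)).mp h1
  · exact d_mem_aux n i h F hF

theorem b_mem (n : ℕ) (F : V A n) (hF : F ∈ CM A n) : b A n F ∈ CM A (n + 1) := by
  rw [b, LinearMap.sum_apply]
  exact Submodule.sum_mem _ fun i hi =>
    Submodule.smul_mem _ _ (d_mem n i (by simp at hi; omega) F hF)

theorem bar_mem (n : ℕ) (F : V A n) (hF : F ∈ CM A n) : bar A n F ∈ CM A (n + 1) := by
  rw [bar, LinearMap.sum_apply]
  exact Submodule.sum_mem _ fun i hi =>
    Submodule.smul_mem _ _ (d_mem n i (by simp at hi; omega) F hF)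

theorem face_cons_zero (n : ℕ) (x : A) (a : Fin (n + 1) → A) :
    face n 0 (Fin.cons x a : Fin (n + 2) → A) = Function.update a 0 (x * a 0) := by
  funext j
  refine Fin.cases ?_ (fun j => ?_) j
  · simp [face]
  · simp [face]

theorem face_cons_succ (n i : ℕ) (hi : i ≤ n) (x : A) (a : Fin (n + 2) → A) :
    face (n + 1) (i + 1) (Fin.cons x a : Fin (n + 3) → A) = Fin.cons x (face n i a) := by
  funext j
  refine Fin.cases ?_ (fun j => ?_) j
  · simp [face, hi]
  · simp only [face, Fin.cons_succ, ← Fin.succ_castSucc, Fin.val_succ]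
    simp [hi]

/-- Acyclicity of the bar complex. -/
theorem bar_acyclic {ι : Type*} (l : Filter ι) [l.NeBot] (e : ι → A) (C : ℝ)
    (hbdd : ∀ i, ‖e i‖ ≤ C)
    (hleft : ∀ a : A, Tendsto (fun i => e i * a) l (nhds a))
    (n : ℕ) (F : V A (n + 1)) (hF : F ∈ CM A (n + 1)) (h0 : bar A (n + 1) F = 0) :
    ∃ G ∈ CM A n, bar A n G = F := by
  obtain ⟨f, rfl⟩ := hF
  let U : Ultrafilter ι := Ultrafilter.of l
  have hU : (U : Filter ι) ≤ l := Ultrafilter.of_le l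
  have hbound : ∀ (a : Fin (n + 1) → A) i,
      ‖f (Fin.cons (e i) a : Fin (n + 2) → A)‖ ≤ (‖f‖ * C) * ∏ j, ‖a j‖ := by
    intro a i
    refine (f.le_opNorm _).trans ?_
    rw [Fin.prod_univ_succ]
    simp only [Fin.cons_zero, Fin.cons_succ]
    rw [← mul_assoc]
    gcongr
    exact hbdd i
  have hlim : ∀ a : Fin (n + 1) → A, ∃ z : ℂ,
      Tendsto (fun i => f (Fin.cons (e i) a : Fin (n + 2) → A)) U (nhds z) := by
    intro a
    have hK := isCompact_closedBall (0 : ℂ) ((‖f‖ * C) * ∏ j, ‖a j‖)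
    obtain ⟨z, _, hz⟩ := hK.ultrafilter_le_nhds
      (U.map (fun i => f (Fin.cons (e i) a : Fin (n + 2) → A))) (by
        rw [le_principal_iff]
        exact Filter.mem_map.mpr (Filter.Eventually.of_forall fun i => by simpa using hbound a i))
    exact ⟨z, hz⟩
  choose G hG using hlim
  have hGmem : G ∈ CM A n := by
    let M : MultilinearMap ℂ (fun _ : Fin (n + 1) => A) ℂ :=
      { toFun := G
        map_update_add' := by
          intro inst a k x y
          have e : inst = instDecidableEqFin (n + 1) := Subsingleton.elim _ _
          subst e
          refine tendsto_nhds_unique (hG _) ?_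
          refine ((hG (Function.update a k x)).add (hG (Function.update a k y))).congr fun i => ?_
          simp only [Fin.cons_update, f.map_update_add]
        map_update_smul' := by
          intro inst a k c x
          have e : inst = instDecidableEqFin (n + 1) := Subsingleton.elim _ _
          subst e
          refine tendsto_nhds_unique (hG _) ?_
          refine ((hG (Function.update a k x)).const_smul c).congr fun i => ?_
          simp only [Fin.cons_update, f.map_update_smul] }
    refine ⟨M.mkContinuous (‖f‖ * C) fun a => ?_, rfl⟩
    exact le_of_tendsto (hG a).norm (Filter.Eventually.of_forall (hbound a))
  refine ⟨G, hGmem, ?_⟩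
  funext a
  have h1 : ∀ i, f (Function.update a 0 (e i * a 0)) =
      ∑ k ∈ range (n + 1), (-1 : ℂ) ^ k * f (Fin.cons (e i) (face n k a) : Fin (n + 2) → A) := by
    intro i
    have h := congrFun h0 (Fin.cons (e i) a : Fin (n + 3) → A)
    simp only [bar, LinearMap.sum_apply, LinearMap.smul_apply, Finset.sum_apply,
      Pi.smul_apply, smul_eq_mul, d, LinearMap.coe_mk, AddHom.coe_mk, Pi.zero_apply] at h
    rw [Finset.sum_range_succ', face_cons_zero] at h
    rw [Finset.sum_congr rfl fun k hk => by
      rw [face_cons_succ n k (by simp at hk; omega), pow_succ, mul_neg_one, neg_mul]] at h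
    rw [Finset.sum_neg_distrib, pow_zero, one_mul] at h
    linear_combination h
  have t1 : Tendsto (fun i => f (Function.update a 0 (e i * a 0))) U (nhds (f a)) := by
    have c : Continuous fun x : A => f (Function.update a 0 x) :=
      f.cont.comp (continuous_const.update 0 continuous_id)
    have := (c.tendsto (a 0)).comp ((hleft (a 0)).mono_left hU)
    rw [Function.update_eq_self] at this
    exact this
  have t2 : Tendsto (fun i => f (Function.update a 0 (e i * a 0))) U
      (nhds (∑ k ∈ range (n + 1), (-1 : ℂ) ^ k * G (face n k a))) := by
    simp only [h1]
    exact tendsto_finsetSum _ fun k _ => (hG (face n k a)).const_mul _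
  have := tendsto_nhds_unique t2 t1
  rw [← this]
  simp [bar, LinearMap.sum_apply, d]

end CM

theorem cycT_iff {A : Type*} (n : ℕ) (f : V A n) : cycT f = f ↔ s A n f = f := by
  have hs : ((-1 : ℂ) ^ n) * (-1) ^ n = 1 := by rw [← mul_pow]; simp
  have h1 : s A n (cycT f) = f := by
    funext a
    have : (fun j => rot n a (j + 1)) = a := by funext j; simp [rot]
    simp [s, cycT, ← mul_assoc, hs, this]
  have h2 : cycT (s A n f) = f := by
    funext a
    have : rot n (fun j => a (j + 1)) = a := by funext j; simp [rot]
    simp [s, cycT, ← mul_assoc, hs, this]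
  constructor
  · intro h; rw [h] at h1; exact h1
  · intro h; rw [h] at h2; exact h2

end CycAux

theorem cyclic_cohomology_vanishes_of_no_traces_and_hochschild_vanishing
    {A : Type*} [NonUnitalNormedRing A] [NormedSpace ℂ A]
    [IsScalarTower ℂ A A] [SMulCommClass ℂ A A] [CompleteSpace A]
    -- bounded approximate identity for `A`
    {ι : Type*} (l : Filter ι) [l.NeBot] (e : ι → A) (C : ℝ)
    (hbdd : ∀ i, ‖e i‖ ≤ C)
    (hleft : ∀ a : A, Tendsto (fun i => e i * a) l (nhds a))
    (hright : ∀ a : A, Tendsto (fun i => a * e i) l (nhds a))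
    -- `A^{tr} = 0`: every continuous trace on `A` vanishes
    (htr : ∀ f : A →L[ℂ] ℂ, (∀ a b : A, f (a * b) = f (b * a)) → f = 0)
    -- `Hⁿ(A, A*) = 0` for all `n ≥ 1`: every Hochschild cocycle of degree `≥ 1`
    -- is a Hochschild coboundary
    (hH : ∀ (n : ℕ) (f : ContinuousMultilinearMap ℂ (fun _ : Fin (n + 2) => A) ℂ),
      cycδ (⇑f) = 0 →
        ∃ g : ContinuousMultilinearMap ℂ (fun _ : Fin (n + 1) => A) ℂ,
          cycδ (⇑g) = ⇑f) :
    -- `HC⁰(A) = 0`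
    (∀ f : ContinuousMultilinearMap ℂ (fun _ : Fin 1 => A) ℂ,
        cycδ (⇑f) = 0 → (⇑f : (Fin 1 → A) → ℂ) = 0)
    -- `HCⁿ(A) = 0` for `n ≥ 1`
    ∧ (∀ (n : ℕ) (f : ContinuousMultilinearMap ℂ (fun _ : Fin (n + 2) => A) ℂ),
        cycT (⇑f) = ⇑f → cycδ (⇑f) = 0 →
          ∃ g : ContinuousMultilinearMap ℂ (fun _ : Fin (n + 1) => A) ℂ,
            cycT (⇑g) = ⇑g ∧ cycδ (⇑g) = ⇑f) := by
  have hH' : ∀ (n : ℕ) (F : CycAux.V A (n + 1)), F ∈ CycAux.CM A (n + 1) →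
      CycAux.b A (n + 1) F = 0 → ∃ G ∈ CycAux.CM A n, CycAux.b A n G = F := by
    rintro n _ ⟨f, rfl⟩ h
    rw [CycAux.b_eq] at h
    obtain ⟨g, hg⟩ := hH n f h
    exact ⟨g, ⟨g, rfl⟩, by rw [CycAux.b_eq, hg]⟩
  have hzero : ∀ f : ContinuousMultilinearMap ℂ (fun _ : Fin 1 => A) ℂ,
      cycδ (⇑f) = 0 → (⇑f : (Fin 1 → A) → ℂ) = 0 := by
    intro f hf
    let L : A →L[ℂ] ℂ :=
      { toFun := fun x => f (fun _ => x)
        map_add' := fun x y => by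
          have := f.map_update_add (fun _ => 0) 0 x y
          convert this using 2 <;> (try congr 1) <;> funext j <;> simp [Subsingleton.elim j 0]
        map_smul' := fun c x => by
          have := f.map_update_smul (fun _ => 0) 0 c x
          convert this using 2 <;> (try congr 1) <;> funext j <;> simp [Subsingleton.elim j 0]
        cont := f.cont.comp (continuous_pi fun _ => continuous_id) }
    have hL : L = 0 := htr L fun x y => by
      have h := congrFun hf ![x, y]
      simp [cycδ] at h
      have h' : f (fun _ => x * y) + -f (fun _ => y * x) = 0 := by
        convert h using 3
        funext j
        simp [Subsingleton.elim j 0, cycMerge]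
      exact add_neg_eq_zero.mp h'
    funext a
    have h := congrArg (fun M : A →L[ℂ] ℂ => M (a 0)) hL
    have ha : a = fun _ => a 0 := by funext j; simp [Subsingleton.elim j 0]
    rw [ha]
    exact h
  have main : ∀ (n : ℕ) (F : CycAux.V A (n + 1)), F ∈ CycAux.CM A (n + 1) →
      CycAux.s A (n + 1) F = F → CycAux.b A (n + 1) F = 0 →
      ∃ G ∈ CycAux.CM A n, CycAux.s A n G = G ∧ CycAux.b A n G = F := by
    intro n
    induction n using Nat.strong_induction_on with
    | _ n ih =>
    intro F hF hs hb
    obtain ⟨g, hgm, hg⟩ := hH' n F hF hb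
    have hbar : CycAux.bar A n (g - CycAux.s A n g) = 0 := by
      have := CycAux.s_b n g
      rw [hg, hs] at this
      rw [map_sub, ← sub_eq_zero.mpr this]
      abel
    rcases n with _ | m
    · refine ⟨g, hgm, ?_, hg⟩
      funext a
      simp only [CycAux.s, LinearMap.coe_mk, AddHom.coe_mk, pow_zero, one_mul]
      congr 1
      funext j
      simp only [CycAux.rot]
      exact congrArg a (Subsingleton.elim (α := Fin 1) _ _)
    · obtain ⟨h, hhm, hh⟩ := CycAux.bar_acyclic l e C hbdd hleft m _
        ((CycAux.CM A (m + 1)).sub_mem hgm (CycAux.s_mem _ _ hgm)) hbar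
      have hN : CycAux.b A m (CycAux.N A m h) = 0 := by
        rw [← CycAux.N_bar, hh, map_sub, CycAux.N_s, sub_self]
      obtain ⟨h', hm', hbh, hNh⟩ : ∃ h' ∈ CycAux.CM A m, CycAux.bar A m h' = CycAux.bar A m h ∧
          CycAux.N A m h' = 0 := by
        rcases m with _ | p
        · refine ⟨h, hhm, rfl, ?_⟩
          obtain ⟨f, hf⟩ := CycAux.N_mem _ _ hhm
          rw [← hf]
          apply hzero
          rw [← CycAux.b_eq, hf, hN]
        · obtain ⟨k, hkm, hks, hk⟩ := ih p (by omega) _ (CycAux.N_mem _ _ hhm)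
            (CycAux.s_N _ _) hN
          have hp1 : ((p : ℂ) + 1) ≠ 0 := by exact_mod_cast Nat.succ_ne_zero p
          refine ⟨h - CycAux.bar A p (((p : ℂ) + 1)⁻¹ • k), (CycAux.CM A (p + 1)).sub_mem hhm
            (CycAux.bar_mem _ _ ((CycAux.CM A p).smul_mem _ hkm)), ?_, ?_⟩
          · rw [map_sub, CycAux.bar_bar, sub_zero]
          · rw [map_sub, CycAux.N_bar, map_smul, CycAux.N_of_inv p k hks, smul_smul,
              inv_mul_cancel₀ hp1, one_smul, hk, sub_self]
      obtain ⟨q, hqm, hq⟩ := CycAux.exists_of_N_eq_zero m (CycAux.CM A m)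
        (CycAux.s_mem m) h' hm' hNh
      refine ⟨g - CycAux.b A m q, (CycAux.CM A (m + 1)).sub_mem hgm (CycAux.b_mem _ _ hqm),
        ?_, ?_⟩
      · have h1 : g - CycAux.s A (m + 1) g = CycAux.bar A m q - CycAux.bar A m (CycAux.s A m q) := by
          rw [← hh, ← hbh, ← hq, map_sub]
        rw [map_sub, CycAux.s_b, ← sub_eq_zero]
        have h2 := sub_eq_zero.mpr h1
        rw [← neg_eq_zero, ← h2]
        abel
      · rw [map_sub, CycAux.b_b, sub_zero, hg]
  refine ⟨hzero, fun n f hs hb => ?_⟩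
  obtain ⟨_, ⟨g, rfl⟩, hgs, hg⟩ := main n f ⟨f, rfl⟩ ((CycAux.cycT_iff _ _).mp hs)
    (by rw [CycAux.b_eq, hb])
  exact ⟨g, (CycAux.cycT_iff _ _).mpr hgs, by rw [← CycAux.b_eq, hg]⟩
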